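/- arXiv:2507.04071 — 2 statements merged into one kernel-verified Lean document; each statement's English description precedes it below -/
import Mathlib

section
/- If R ≡_α C (R and C are α-convertible) then ⟦R⟧ = ⟦C⟧ for every interpretation ⟦·⟧. -/
namespace Paper

/-- Terms of the bare bones dependent type system (Part 1): constants `c n`,
variables `v n`, dependent products `ρR`, applications `βRS` and abstractions `λxRS`. -/
inductive Tm : Type
  | const : ℕ → Tm
  | var : ℕ → Tm
  | rho : Tm → Tm
  | app : Tm → Tm → Tm
  | lam : ℕ → Tm → Tm → Tm
  deriving DecidableEq

namespace Tm

/-- The size of a term. -/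
def size : Tm → ℕ
  | const _ => 1
  | var _ => 1
  | rho R => R.size + 1
  | app R S => R.size + S.size + 1
  | lam _ R S => R.size + S.size + 1

/-- The free variables `F(T)` of a term. -/
def fv : Tm → Finset ℕ
  | const _ => ∅
  | var x => {x}
  | rho R => R.fv
  | app R S => R.fv ∪ S.fv
  | lam x R S => R.fv ∪ (S.fv \ {x})

/-- The bound variables `B(T)` of a term. -/
def bv : Tm → Finset ℕ
  | const _ => ∅
  | var _ => ∅
  | rho R => R.bv
  | app R S => R.bv ∪ S.bv
  | lam x R S => (R.bv ∪ S.bv) ∪ {x}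

/-- All variables `V(T) = F(T) ∪ B(T)` occurring in a term. -/
def vars (t : Tm) : Finset ℕ := t.fv ∪ t.bv

/-- A fixed choice of a variable outside a given finite set of variables. -/
def fresh (s : Finset ℕ) : ℕ := s.sup id + 1

theorem fresh_not_mem (s : Finset ℕ) : fresh s ∉ s := by
  intro h
  have := Finset.le_sup (f := id) h
  simp only [id] at this
  simp only [fresh] at this
  omega

/-- Capture-avoiding renaming `S[z/y]` (substitution of the variable `z` for the
variable `y`), implemented with a fuel parameter and carrying the fact that it
preserves the size of the term. -/
def renameAux : (n : ℕ) → (S : Tm) → S.size ≤ n → (z y : ℕ) → {t : Tm // t.size = S.size}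
  | _, const a, _, _, _ => ⟨const a, rfl⟩
  | _, var v, _, z, y => if v = y then ⟨var z, rfl⟩ else ⟨var v, rfl⟩
  | 0, rho _, h, _, _ => absurd h (by simp only [size]; omega)
  | n + 1, rho R, h, z, y =>
      let R' := renameAux n R (by simp only [size] at h; omega) z y
      ⟨rho R'.1, by simp only [size, R'.2]⟩
  | 0, app _ _, h, _, _ => absurd h (by simp only [size]; omega)
  | n + 1, app R S, h, z, y =>
      let R' := renameAux n R (by simp only [size] at h; omega) z y
      let S' := renameAux n S (by simp only [size] at h; omega) z y
      ⟨app R'.1 S'.1, by simp only [size, R'.2, S'.2]⟩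
  | 0, lam _ _ _, h, _, _ => absurd h (by simp only [size]; omega)
  | n + 1, lam w R S, h, z, y =>
      let R' := renameAux n R (by simp only [size] at h; omega) z y
      if w = y ∨ y ∉ S.fv then
        ⟨lam w R'.1 S, by simp only [size, R'.2]⟩
      else if w ≠ z then
        -- here `w ∉ F(z)`, so the chosen fresh variable is `w` itself
        let S' := renameAux n S (by simp only [size] at h; omega) z y
        ⟨lam w R'.1 S'.1, by simp only [size, R'.2, S'.2]⟩
      else
        let z' := fresh ((var z).vars ∪ S.vars)
        let S₁ := renameAux n S (by simp only [size] at h; omega) z' w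
        let S₂ := renameAux n S₁.1 (by rw [S₁.2]; simp only [size] at h; omega) z y
        ⟨lam z' R'.1 S₂.1, by simp only [size, S₂.2, S₁.2, R'.2]⟩

/-- Capture-avoiding renaming `S[z/y]` of the variable `y` to the variable `z`. -/
def rename (S : Tm) (z y : ℕ) : Tm := (renameAux S.size S le_rfl z y).1

theorem size_rename (S : Tm) (z y : ℕ) : (rename S z y).size = S.size :=
  (renameAux S.size S le_rfl z y).2

/-- Capture-avoiding substitution `S[T/x]` of the term `T` for the variable `x` in `S`,
renaming bound variables (using the fixed choice `fresh`) to avoid capture. -/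
def subst : Tm → Tm → ℕ → Tm
  | const a, _, _ => const a
  | var v, T, x => if v = x then T else var v
  | rho R, T, x => rho (subst R T x)
  | app R S, T, x => app (subst R T x) (subst S T x)
  | lam w R S, T, x =>
      if w = x ∨ x ∉ S.fv then lam w (subst R T x) S
      else if w ∉ T.fv then lam w (subst R T x) (subst S T x)
      else lam (fresh (T.vars ∪ S.vars)) (subst R T x)
        (subst (rename S (fresh (T.vars ∪ S.vars)) w) T x)
termination_by S _ _ => S.size
decreasing_by all_goals (simp only [size, size_rename]; omega)

end Tm

end Paper
namespace Paper

open ZFSet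

/-- The application `R(s) = ⋃ R{s} = ⋃ {r | ⟨r,s⟩ ∈ R}` of a set to a set
(ordered pairs `⟨r,s⟩` are Kuratowski pairs `ZFSet.pair r s`). -/
noncomputable def sApp (R s : ZFSet.{0}) : ZFSet :=
  ⋃₀ (ZFSet.sep (fun r => ZFSet.pair r s ∈ R) (⋃₀ (⋃₀ R)))

/-- The domain `dom(S) = {d | ∃ r, ⟨r,d⟩ ∈ S}` of a set. -/
noncomputable def sDom (S : ZFSet.{0}) : ZFSet :=
  ZFSet.sep (fun d => ∃ r, ZFSet.pair r d ∈ S) (⋃₀ (⋃₀ S))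

/-- The range `ran(S) = {r | ∃ d, ⟨r,d⟩ ∈ S}` of a set. -/
noncomputable def sRan (S : ZFSet.{0}) : ZFSet :=
  ZFSet.sep (fun r => ∃ d, ZFSet.pair r d ∈ S) (⋃₀ (⋃₀ S))

/-- `F` is a function: a set of ordered pairs `⟨value, argument⟩` which, for each
`d` in its domain, contains a unique pair with second component `d`. -/
def IsFun (F : ZFSet.{0}) : Prop :=
  (∀ p ∈ F, ∃ r d, p = ZFSet.pair r d) ∧
    ∀ d r r', ZFSet.pair r d ∈ F → ZFSet.pair r' d ∈ F → r = r'

/-- The dependent product `∏F`: the set of all functions `f` with `dom f = dom F`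
such that `f(d) ∈ F(d)` for every `d ∈ dom F` (with the paper's convention that
functions are sets of pairs `⟨value, argument⟩`). -/
noncomputable def dprod (F : ZFSet.{0}) : ZFSet :=
  ZFSet.sep
    (fun f => IsFun f ∧ sDom f = sDom F ∧ ∀ d ∈ sDom F, sApp f d ∈ sApp F d)
    (ZFSet.powerset (ZFSet.prod (⋃₀ (sRan F)) (sDom F)))

/-- The set `{⟨f r, r⟩ : r ∈ X}`, i.e. the graph (in the paper's convention) of the
function sending each `r ∈ X` to `f r`. -/
noncomputable def lamSet (X : ZFSet.{0}) (f : ZFSet.{0} → ZFSet.{0}) : ZFSet :=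
  @ZFSet.image (fun r => ZFSet.pair (f r) r) (Classical.allZFSetDefinable _) X

/-- An assignment of sets to the constants and the variables. -/
structure Asn where
  c : ℕ → ZFSet.{0}
  v : ℕ → ZFSet.{0}

/-- The assignment modified to send the variable `x` to the set `s`. -/
noncomputable def Asn.update (A : Asn) (x : ℕ) (s : ZFSet.{0}) : Asn :=
  ⟨A.c, Function.update A.v x s⟩

/-- The interpretation `⟦·⟧` of terms determined by an assignment:
`⟦ρS⟧ = ∏⟦S⟧`, `⟦βRS⟧ = ⟦R⟧(⟦S⟧)` and `⟦λxRS⟧ = {⟨⟦S⟧_{⟨r,x⟩}, r⟩ : r ∈ ⟦R⟧}`. -/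
noncomputable def interp : Tm → Asn → ZFSet
  | Tm.const a, A => A.c a
  | Tm.var x, A => A.v x
  | Tm.rho R, A => dprod (interp R A)
  | Tm.app R S, A => sApp (interp R A) (interp S A)
  | Tm.lam x R S, A => lamSet (interp R A) (fun r => interp S (A.update x r))

end Paper
namespace Paper

/-- The head α-conversion relation
`≡^α = {⟨λxRS, λyR(S[y/x])⟩ : x ∉ B(S) and y ∉ V(S)}`. -/
def HeadAlpha (A B : Tm) : Prop :=
  ∃ (x y : ℕ) (R S : Tm), x ∉ S.bv ∧ y ∉ S.vars ∧
    A = Tm.lam x R S ∧ B = Tm.lam y R (S.subst (Tm.var y) x)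

end Paper
namespace Paper

/-- The contextual closure of a relation on terms: the smallest relation
containing it such that `R ▷ C` implies `βSR ▷ βSC`, `βRS ▷ βCS`, `λxSR ▷ λxSC`,
`λxRS ▷ λxCS` and `ρR ▷ ρC`. -/
inductive Ctx (r : Tm → Tm → Prop) : Tm → Tm → Prop
  | base {R C : Tm} : r R C → Ctx r R C
  | appLeft {R C S : Tm} : Ctx r R C → Ctx r (Tm.app R S) (Tm.app C S)
  | appRight {R C S : Tm} : Ctx r R C → Ctx r (Tm.app S R) (Tm.app S C)
  | lamDom {R C S : Tm} {x : ℕ} : Ctx r R C → Ctx r (Tm.lam x R S) (Tm.lam x C S)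
  | lamBody {R C S : Tm} {x : ℕ} : Ctx r R C → Ctx r (Tm.lam x S R) (Tm.lam x S C)
  | rho {R C : Tm} : Ctx r R C → Ctx r (Tm.rho R) (Tm.rho C)

/-- α-conversion `≡_α`: the reflexive transitive contextual closure of
head α-conversion. -/
def AlphaEq : Tm → Tm → Prop := Relation.ReflTransGen (Ctx HeadAlpha)

end Paper

namespace Paper

/-- The coincidence lemma: an interpretation depends only on the values of the constants
and of the free variables. -/
theorem interp_congr (S : Tm) {A B : Asn} (hc : A.c = B.c) (hv : ∀ x ∈ S.fv, A.v x = B.v x) :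
    interp S A = interp S B := by
  induction S generalizing A B with
  | const a => simp [interp, hc]
  | var x => exact hv x (by simp [Tm.fv])
  | rho R ih => simp only [interp]; rw [ih hc hv]
  | app R S ihR ihS =>
    simp only [interp]
    rw [ihR hc fun x hx => hv x (by simp [Tm.fv, hx]),
      ihS hc fun x hx => hv x (by simp [Tm.fv, hx])]
  | lam w R S ihR ihS =>
    simp only [interp]
    rw [ihR hc fun x hx => hv x (by simp [Tm.fv, hx])]
    congr 1
    funext r
    refine ihS hc fun x hx => ?_
    by_cases h : x = w
    · simp [Asn.update, h]
    · simpa [Asn.update, h] using hv x (by simp [Tm.fv, hx, h])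

theorem interp_update_of_notMem {S : Tm} {x : ℕ} (hx : x ∉ S.fv) (A : Asn) (s : ZFSet) :
    interp S (A.update x s) = interp S A :=
  interp_congr S rfl fun y hy => by
    have : y ≠ x := by rintro rfl; exact hx hy
    simp [Asn.update, this]

theorem Asn.update_comm (A : Asn) {x y : ℕ} (h : x ≠ y) (s t : ZFSet) :
    (A.update x s).update y t = (A.update y t).update x s := by
  simp [Asn.update, Function.update_comm h]

theorem Asn.update_idem (A : Asn) (x : ℕ) (s t : ZFSet) :
    (A.update x s).update x t = A.update x t := by
  simp [Asn.update]

theorem Asn.update_v_self (A : Asn) (x : ℕ) (s : ZFSet) : (A.update x s).v x = s := by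
  simp [Asn.update]

theorem Asn.update_v_of_ne (A : Asn) {x y : ℕ} (h : y ≠ x) (s : ZFSet) :
    (A.update x s).v y = A.v y := by
  simp [Asn.update, h]

/-- An update of a variable that is rebound or not free in the body of an abstraction is
irrelevant to that body. -/
theorem interp_update_update_of_irrelevant {S : Tm} {w x : ℕ} (h : w = x ∨ x ∉ S.fv)
    (A : Asn) (r s : ZFSet) :
    interp S ((A.update x s).update w r) = interp S (A.update w r) := by
  by_cases hw : w = x
  · rw [hw, Asn.update_idem]
  · rw [Asn.update_comm A (Ne.symm hw), interp_update_of_notMem (h.resolve_left hw)]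

theorem interp_renameAux (n : ℕ) (S : Tm) (h : S.size ≤ n) (z y : ℕ) (A : Asn) :
    interp (Tm.renameAux n S h z y).1 A = interp S (A.update y (A.v z)) := by
  induction n generalizing S z y A with
  | zero => cases S <;> simp [Tm.size] at h
  | succ n ih =>
    cases S with
    | const a => simp [Tm.renameAux, interp, Asn.update]
    | var v =>
      by_cases hv : v = y <;> simp [Tm.renameAux, hv, interp, Asn.update]
    | rho R => simp [Tm.renameAux, interp, ih]
    | app R S => simp [Tm.renameAux, interp, ih]
    | lam w R S =>
      rw [Tm.renameAux]
      split_ifs with h₁ h₂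
      · simp only [interp, ih]
        congr 1
        funext r
        exact (interp_update_update_of_irrelevant h₁ A r _).symm
      · obtain ⟨hwy, -⟩ := not_or.mp h₁
        simp only [interp, ih]
        congr 1
        funext r
        rw [Asn.update_v_of_ne A (Ne.symm h₂), Asn.update_comm A hwy]
      · obtain ⟨hwy, hy⟩ := not_or.mp h₁
        have hf := Tm.fresh_not_mem ((Tm.var z).vars ∪ S.vars)
        simp only [interp, ih]
        generalize Tm.fresh ((Tm.var z).vars ∪ S.vars) = z' at hf ⊢
        simp only [Tm.vars, Tm.fv, Finset.mem_union, Finset.mem_singleton, not_or] at hf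
        obtain ⟨⟨hz, -⟩, hS, -⟩ := hf
        have hz'y : z' ≠ y := by rintro rfl; exact hy hS
        congr 1
        funext r
        rw [Asn.update_v_of_ne A (Ne.symm hz), Asn.update_comm A hz'y, Asn.update_v_self,
          Asn.update_comm _ (by rintro rfl; exact h₂ hz),
          interp_update_of_notMem hS]

theorem interp_rename (S : Tm) (z y : ℕ) (A : Asn) :
    interp (S.rename z y) A = interp S (A.update y (A.v z)) :=
  interp_renameAux S.size S le_rfl z y A

/-- The substitution lemma: substituting a term for a variable amounts to updating the
assignment at that variable. -/
theorem interp_subst (S T : Tm) (x : ℕ) (A : Asn) :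
    interp (S.subst T x) A = interp S (A.update x (interp T A)) := by
  induction hn : S.size using Nat.strong_induction_on generalizing S A with
  | _ n ih =>
    subst hn
    cases S with
    | const a => simp [Tm.subst, interp, Asn.update]
    | var v => by_cases hv : v = x <;> simp [Tm.subst, hv, interp, Asn.update]
    | rho R =>
      rw [Tm.subst, interp, interp, ih _ (by simp [Tm.size]) R A rfl]
    | app R S =>
      rw [Tm.subst, interp, interp, ih _ (by simp only [Tm.size]; omega) R A rfl,
        ih _ (by simp only [Tm.size]; omega) S A rfl]
    | lam w R S =>
      have hR := ih _ (by simp only [Tm.size]; omega) R A rfl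
      rw [Tm.subst]
      split_ifs with h₁ h₂
      · simp only [interp, hR]
        congr 1
        funext r
        exact (interp_update_update_of_irrelevant h₁ A r _).symm
      · obtain ⟨hwx, hx⟩ := not_or.mp h₁
        have hf := Tm.fresh_not_mem (T.vars ∪ S.vars)
        generalize Tm.fresh (T.vars ∪ S.vars) = z at hf ⊢
        simp only [Tm.vars, Finset.mem_union, not_or] at hf
        obtain ⟨⟨hT, -⟩, hS, -⟩ := hf
        have hzx : z ≠ x := by rintro rfl; exact hx hS
        have hzw : z ≠ w := by rintro rfl; exact hT h₂
        simp only [interp, hR]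
        congr 1
        funext r
        rw [ih _ (by simp only [Tm.size, Tm.size_rename]; omega) (S.rename z w) _ rfl,
          interp_rename, interp_update_of_notMem hT, Asn.update_comm A hzx,
          Asn.update_v_self, Asn.update_comm _ hzw, interp_update_of_notMem hS]
      · obtain ⟨hwx, -⟩ := not_or.mp h₁
        simp only [interp, hR]
        congr 1
        funext r
        rw [ih _ (by simp only [Tm.size]; omega) S _ rfl, interp_update_of_notMem h₂,
          Asn.update_comm A hwx]

theorem HeadAlpha.interp_eq {R C : Tm} (h : HeadAlpha R C) (A : Asn) :
    interp R A = interp C A := by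
  obtain ⟨x, y, R, S, -, hy, rfl, rfl⟩ := h
  have hyS : y ∉ S.fv := fun h => hy (Finset.mem_union_left _ h)
  simp only [interp]
  congr 1
  funext r
  rw [interp_subst, interp, Asn.update_v_self]
  by_cases hxy : x = y
  · rw [hxy, Asn.update_idem]
  · rw [Asn.update_comm A (Ne.symm hxy), interp_update_of_notMem hyS]

theorem Ctx.interp_eq {r : Tm → Tm → Prop}
    (hr : ∀ R C, r R C → ∀ A, interp R A = interp C A) {R C : Tm} (h : Ctx r R C) (A : Asn) :
    interp R A = interp C A := by
  induction h generalizing A with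
  | base h => exact hr _ _ h A
  | _ _ ih => simp only [interp, ih]

/-- α-convertible terms have the same interpretation under every
interpretation. -/
theorem interp_eq_of_alphaEq (R C : Tm) :
    AlphaEq R C → ∀ A : Asn, interp R A = interp C A := by
  intro h A
  induction h with
  | refl => rfl
  | tail _ h ih => exact ih.trans (Ctx.interp_eq (fun _ _ => HeadAlpha.interp_eq) h A)

end Paper
end

section
/- Substitution invariance: for any n ∈ ω, set of typing statements Γ, terms P, S, T and variable x, if Γ ⊢_n (S:P) then Γ[T/x] ⊢_n (S[T/x] : P[T/x]), where Γ[T/x] = {(S'[T/x] : P'[T/x]) | (S':P') ∈ Γ}. -/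
namespace Paper

/-- The setoid of α-conversion: the equivalence relation generated by the
contextual closure of head α-conversion (which coincides with `AlphaEq`). -/
def alphaSetoid : Setoid Tm := Relation.EqvGen.setoid (Ctx HeadAlpha)

/-- α-equivalence classes of terms. -/
def QTm := Quotient alphaSetoid

/-- The α-equivalence class `[T]_α` of a term. -/
def cls (t : Tm) : QTm := Quotient.mk alphaSetoid t

/-- Typing statements `(S : P)`: pairs of α-equivalence classes of terms. -/
abbrev Stmt := QTm × QTm

/-- The free variables of an α-equivalence class, i.e. the union of the free
variables of its representatives (free variables are α-invariant). -/
def Fq (q : QTm) : Set ℕ := {v | ∃ T : Tm, cls T = q ∧ v ∈ T.fv}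

/-- The free variables `F(Γ)` of a set of typing statements: the union of the
free variables of the subjects and predicates of its statements. -/
def FSet (Γ : Set Stmt) : Set ℕ := {v | ∃ st ∈ Γ, v ∈ Fq st.1 ∨ v ∈ Fq st.2}

/-- The product term `πxRS := ρλxRS`. -/
def Tm.pi (x : ℕ) (R S : Tm) : Tm := Tm.rho (Tm.lam x R S)

end Paper
namespace Paper

/-- One step of the stratification: `Step prev` is the smallest monotone
reflexive relation satisfying (App) and (Ab) with premises taken from `prev`. -/
inductive Step (prev : Set Stmt → Stmt → Prop) : Set Stmt → Stmt → Prop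
  | mem {Γ : Set Stmt} {st : Stmt} : st ∈ Γ → Step prev Γ st
  | mono {Γ Δ : Set Stmt} {st : Stmt} : Δ ⊆ Γ → Step prev Δ st → Step prev Γ st
  | app {Γ : Set Stmt} (F S P R : Tm) (x : ℕ) :
      prev Γ (cls F, cls (Tm.pi x P R)) → prev Γ (cls S, cls P) →
      Step prev Γ (cls (Tm.app F S), cls (R.subst S x))
  | ab {Γ : Set Stmt} (Q S P : Tm) (y : ℕ) :
      y ∉ FSet Γ → y ∉ Q.fv →
      prev (Γ ∪ {(cls (Tm.var y), cls Q)}) (cls S, cls P) →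
      Step prev Γ (cls (Tm.lam y Q S), cls (Tm.pi y Q P))

/-- The stratified inference relations `⊢_n`: `⊢_0` is the smallest monotone
reflexive relation (i.e. membership) and `⊢_{n+1} = Step ⊢_n`. -/
def DeriveN : ℕ → Set Stmt → Stmt → Prop
  | 0 => fun Γ st => st ∈ Γ
  | n + 1 => Step (DeriveN n)

end Paper

namespace Paper

/-- The substitution `Γ[T/x]` of a set of typing statements. -/
def substSet (Γ : Set Stmt) (T : Tm) (x : ℕ) : Set Stmt :=
  {st | ∃ S' P' : Tm, (cls S', cls P') ∈ Γ ∧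
    st = (cls (S'.subst T x), cls (P'.subst T x))}

/-- Locally nameless terms: bound variables are de Bruijn indices, free variables are named. -/
inductive Ln : Type
  | const : ℕ → Ln
  | bvar : ℕ → Ln
  | fvar : ℕ → Ln
  | rho : Ln → Ln
  | app : Ln → Ln → Ln
  | lam : Ln → Ln → Ln

namespace Ln

/-- The free variables of a locally nameless term. -/
def fv : Ln → Finset ℕ
  | const _ => ∅
  | bvar _ => ∅
  | fvar x => {x}
  | rho R => R.fv
  | app R S => R.fv ∪ S.fv
  | lam R S => R.fv ∪ S.fv

/-- Replace the free variable `x` by the index `k` (shifted under binders). -/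
def close (x : ℕ) : ℕ → Ln → Ln
  | _, const a => const a
  | _, bvar i => bvar i
  | k, fvar v => if v = x then bvar k else fvar v
  | k, rho R => rho (close x k R)
  | k, app R S => app (close x k R) (close x k S)
  | k, lam R S => lam (close x k R) (close x (k + 1) S)

/-- Substitution of `U` for the free variable `x`. -/
def subst (x : ℕ) (U : Ln) : Ln → Ln
  | const a => const a
  | bvar i => bvar i
  | fvar v => if v = x then U else fvar v
  | rho R => rho (subst x U R)
  | app R S => app (subst x U R) (subst x U S)
  | lam R S => lam (subst x U R) (subst x U S)

/-- All dangling indices are below `k`. -/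
def LcAt : ℕ → Ln → Prop
  | _, const _ => True
  | k, bvar i => i < k
  | _, fvar _ => True
  | k, rho R => LcAt k R
  | k, app R S => LcAt k R ∧ LcAt k S
  | k, lam R S => LcAt k R ∧ LcAt (k + 1) S

theorem fv_close (x k : ℕ) (s : Ln) : (close x k s).fv = s.fv \ {x} := by
  induction s generalizing k with
  | const | bvar => simp [close, fv]
  | fvar v =>
    by_cases h : v = x
    · simp [close, fv, h]
    · ext u
      simp only [close, fv, h, if_false, Finset.mem_sdiff, Finset.mem_singleton]
      grind
  | rho R ih => simp [close, fv, ih]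
  | app R S ihR ihS => simp [close, fv, ihR, ihS, Finset.union_sdiff_distrib]
  | lam R S ihR ihS => simp [close, fv, ihR, ihS, Finset.union_sdiff_distrib]

theorem subst_of_notMem {x : ℕ} {s : Ln} (U : Ln) (h : x ∉ s.fv) : subst x U s = s := by
  induction s with
  | const | bvar => rfl
  | fvar v => simp [fv] at h; simp [subst, Ne.symm h]
  | rho R ih => simp_all [fv, subst]
  | app R S ihR ihS => simp_all [fv, subst]
  | lam R S ihR ihS => simp_all [fv, subst]

theorem close_of_notMem {x : ℕ} {s : Ln} (k : ℕ) (h : x ∉ s.fv) : close x k s = s := by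
  induction s generalizing k with
  | const | bvar => rfl
  | fvar v => simp [fv] at h; simp [close, Ne.symm h]
  | rho R ih => simp_all [fv, close]
  | app R S ihR ihS => simp_all [fv, close]
  | lam R S ihR ihS => simp_all [fv, close]

theorem fv_subst_subset (x : ℕ) (U s : Ln) : (subst x U s).fv ⊆ s.fv ∪ U.fv := by
  induction s with
  | const | bvar => simp [subst, fv]
  | fvar v => by_cases h : v = x <;> simp [subst, fv, h]
  | rho R ih => simpa [subst, fv] using ih
  | app R S ihR ihS => simp only [subst, fv]; grind
  | lam R S ihR ihS => simp only [subst, fv]; grind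

theorem close_subst_fvar {z : ℕ} {s : Ln} (w k : ℕ) (h : z ∉ s.fv) :
    close z k (subst w (fvar z) s) = close w k s := by
  induction s generalizing k with
  | const | bvar => rfl
  | fvar v =>
    simp [fv] at h
    by_cases hv : v = w
    · simp [subst, close, hv]
    · simp [subst, close, hv, Ne.symm h]
  | rho R ih => simp_all [fv, close, subst]
  | app R S ihR ihS => simp_all [fv, close, subst]
  | lam R S ihR ihS => simp_all [fv, close, subst]

theorem close_subst {z y : ℕ} {U : Ln} (k : ℕ) (s : Ln) (hzy : z ≠ y) (hz : z ∉ U.fv) :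
    close z k (subst y U s) = subst y U (close z k s) := by
  induction s generalizing k with
  | const | bvar => rfl
  | fvar v =>
    by_cases hv : v = y
    · simp [subst, close, hv, hzy.symm, close_of_notMem k hz]
    · by_cases hvz : v = z <;> simp [subst, close, hv, hvz, hzy]
  | rho R ih => simp_all [close, subst]
  | app R S ihR ihS => simp_all [close, subst]
  | lam R S ihR ihS => simp_all [close, subst]

theorem close_subst_subst {z x : ℕ} {s U : Ln} (w k : ℕ) (hs : z ∉ s.fv) (hzx : z ≠ x)
    (hU : z ∉ U.fv) :
    close z k (subst x U (subst w (fvar z) s)) = subst x U (close w k s) := by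
  rw [close_subst _ _ hzx hU, close_subst_fvar _ _ hs]

theorem subst_subst_subst {z x : ℕ} {s T : Ln} (w : ℕ) (U : Ln) (hs : z ∉ s.fv) (hzx : z ≠ x)
    (hT : z ∉ T.fv) :
    subst z (subst x T U) (subst x T (subst w (fvar z) s)) = subst x T (subst w U s) := by
  induction s with
  | const | bvar => rfl
  | fvar v =>
    simp [fv] at hs
    by_cases hw : v = w
    · simp [subst, hw, hzx]
    · by_cases hx : v = x
      · subst hx; simp [subst, hw, subst_of_notMem _ hT]
      · simp [subst, hw, hx, Ne.symm hs]
  | rho R ih => simp_all [fv, subst]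
  | app R S ihR ihS => simp_all [fv, subst]
  | lam R S ihR ihS => simp_all [fv, subst]

theorem LcAt.close {k : ℕ} {s : Ln} (x : ℕ) (h : LcAt k s) : LcAt (k + 1) (close x k s) := by
  induction s generalizing k with
  | const => trivial
  | bvar i => simp only [LcAt, Ln.close] at *; omega
  | fvar v => by_cases hv : v = x <;> simp [LcAt, Ln.close, hv]
  | rho R ih => exact ih h
  | app R S ihR ihS => exact ⟨ihR h.1, ihS h.2⟩
  | lam R S ihR ihS => exact ⟨ihR h.1, ihS h.2⟩

theorem close_injective {x k : ℕ} {s t : Ln} (hs : LcAt k s) (ht : LcAt k t)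
    (h : close x k s = close x k t) : s = t := by
  induction s generalizing k t with
  | const a => cases t <;> grind [close, LcAt]
  | bvar i => cases t <;> grind [close, LcAt]
  | fvar v => cases t <;> grind [close, LcAt]
  | rho R ih => cases t <;> grind [close, LcAt]
  | app R S ihR ihS => cases t <;> grind [close, LcAt]
  | lam R S ihR ihS => cases t <;> grind [close, LcAt]

end Ln

namespace Tm

/-- The locally nameless form of a term. -/
def toLn : Tm → Ln
  | const a => .const a
  | var v => .fvar v
  | rho R => .rho R.toLn
  | app R S => .app R.toLn S.toLn
  | lam x R S => .lam R.toLn (S.toLn.close x 0)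

theorem fv_toLn (S : Tm) : S.toLn.fv = S.fv := by
  induction S with
  | const | var => rfl
  | rho R ih => simpa [toLn, Ln.fv, fv] using ih
  | app R S ihR ihS => simp [toLn, Ln.fv, fv, ihR, ihS]
  | lam x R S ihR ihS => simp [toLn, Ln.fv, fv, ihR, ihS, Ln.fv_close]

theorem lcAt_toLn (S : Tm) : S.toLn.LcAt 0 := by
  induction S with
  | const | var => trivial
  | rho R ih => exact ih
  | app R S ihR ihS => exact ⟨ihR, ihS⟩
  | lam x R S ihR ihS => exact ⟨ihR, ihS.close x⟩

theorem subst_close_of_eq_or_notMem {w x : ℕ} {S : Tm} (U : Ln) (h : w = x ∨ x ∉ S.fv) :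
    Ln.subst x U (S.toLn.close w 0) = S.toLn.close w 0 := by
  apply Ln.subst_of_notMem
  rw [Ln.fv_close, fv_toLn]
  grind

theorem toLn_renameAux (n : ℕ) (S : Tm) (h : S.size ≤ n) (z y : ℕ) :
    (renameAux n S h z y).1.toLn = Ln.subst y (.fvar z) S.toLn := by
  induction n generalizing S z y with
  | zero => cases S <;> simp [size] at h
  | succ n ih =>
    cases S with
    | const a => simp [renameAux, toLn, Ln.subst]
    | var v => by_cases hv : v = y <;> simp [renameAux, toLn, Ln.subst, hv]
    | rho R => simp [renameAux, toLn, Ln.subst, ih]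
    | app R S => simp [renameAux, toLn, Ln.subst, ih]
    | lam w R S =>
      simp only [renameAux]
      split_ifs with h1 h2
      · simp [toLn, Ln.subst, ih, subst_close_of_eq_or_notMem _ h1]
      · push Not at h1
        simp only [toLn, Ln.subst, ih]
        rw [Ln.close_subst _ _ h1.1 (by simpa [Ln.fv] using h2)]
      · push Not at h1
        have hf := fresh_not_mem ((var z).vars ∪ S.vars)
        simp only [vars, Finset.mem_union, not_or] at hf
        simp only [toLn, Ln.subst, ih]
        rw [Ln.close_subst_subst]
        · rw [fv_toLn]; exact hf.2.1
        · intro e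
          exact hf.2.1 (by simpa only [vars, ← e] using h1.2)
        · exact hf.1.1

theorem toLn_rename (S : Tm) (z y : ℕ) :
    (S.rename z y).toLn = Ln.subst y (.fvar z) S.toLn :=
  toLn_renameAux _ _ _ _ _

theorem toLn_subst (S T : Tm) (x : ℕ) : (S.subst T x).toLn = Ln.subst x T.toLn S.toLn := by
  induction S, T, x using subst.induct with
  | case1 a T x => simp [subst, toLn, Ln.subst]
  | case2 T x => simp [subst, toLn, Ln.subst]
  | case3 v T x h => simp [subst, toLn, Ln.subst, h]
  | case4 R T x ih => simp [subst, toLn, Ln.subst, ih]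
  | case5 R S T x ihR ihS => simp [subst, toLn, Ln.subst, ihR, ihS]
  | case6 w R S T x h ih =>
    rw [subst, if_pos h]
    simp [toLn, Ln.subst, ih, subst_close_of_eq_or_notMem _ h]
  | case7 w R S T x h hw ihR ihS =>
    rw [subst, if_neg h, if_pos hw]
    push Not at h
    simp only [toLn, Ln.subst, ihR, ihS]
    rw [Ln.close_subst _ _ h.1 (by rwa [fv_toLn])]
  | case8 w R S T x h hw ihR ihS =>
    rw [subst, if_neg h, if_neg hw]
    push Not at h
    have hf := fresh_not_mem (T.vars ∪ S.vars)
    simp only [toLn, Ln.subst, ihR, ihS, toLn_rename]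
    generalize fresh (T.vars ∪ S.vars) = z at hf ⊢
    rw [Ln.close_subst_subst]
    · rw [fv_toLn]
      exact fun e => hf (by simp [vars, e])
    · rintro rfl
      exact hf (by simp [vars, h.2])
    · rw [fv_toLn]
      exact fun e => hf (by simp [vars, e])

theorem bv_subst_var {x y : ℕ} {S : Tm} (hx : x ∉ S.bv) (hy : y ∉ S.bv) :
    (S.subst (var y) x).bv = S.bv := by
  induction S with
  | const => simp [subst]
  | var v => by_cases h : v = x <;> simp [subst, h, bv]
  | rho R ih => simp_all [subst, bv]
  | app R S ihR ihS => simp_all [subst, bv]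
  | lam w R S ihR ihS =>
    simp only [bv, Finset.mem_union, Finset.mem_singleton, not_or] at hx hy
    have hw : w ∉ (var y).fv := by simpa [fv] using Ne.symm hy.2
    rw [subst]
    split_ifs with h
    · simp [bv, ihR hx.1.1 hy.1.1]
    · simp [bv, ihR hx.1.1 hy.1.1, ihS hx.1.2 hy.1.2]

theorem size_subst_var {x y : ℕ} {S : Tm} (hx : x ∉ S.bv) (hy : y ∉ S.bv) :
    (S.subst (var y) x).size = S.size := by
  induction S with
  | const => simp [subst]
  | var v => by_cases h : v = x <;> simp [subst, h, size]
  | rho R ih => simp_all [subst, bv, size]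
  | app R S ihR ihS => simp_all [subst, bv, size]
  | lam w R S ihR ihS =>
    simp only [bv, Finset.mem_union, Finset.mem_singleton, not_or] at hx hy
    have hw : w ∉ (var y).fv := by simpa [fv] using Ne.symm hy.2
    rw [subst]
    split_ifs with h
    · simp [size, ihR hx.1.1 hy.1.1]
    · simp [size, ihR hx.1.1 hy.1.1, ihS hx.1.2 hy.1.2]

end Tm

open Tm

theorem HeadAlpha.toLn_eq {A B : Tm} (h : HeadAlpha A B) : A.toLn = B.toLn := by
  obtain ⟨x, y, R, S, -, hy, rfl, rfl⟩ := h
  simp only [toLn, toLn_subst]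
  rw [Ln.close_subst_fvar]
  rw [fv_toLn]
  exact fun e => hy (by simp [vars, e])

theorem toLn_eq_of_ctx {A B : Tm} (h : Ctx HeadAlpha A B) : A.toLn = B.toLn := by
  induction h with
  | base h => exact h.toLn_eq
  | _ => simp_all [toLn]

theorem toLn_eq_of_cls_eq {A B : Tm} (h : cls A = cls B) : A.toLn = B.toLn := by
  have h' : Relation.EqvGen (Ctx HeadAlpha) A B := Quotient.exact h
  induction h' with
  | rel _ _ hr => exact toLn_eq_of_ctx hr
  | refl => rfl
  | symm _ _ _ ih => exact (ih h.symm).symm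
  | trans A B C h₁ h₂ ih₁ ih₂ => exact (ih₁ (Quotient.sound h₁)).trans (ih₂ (Quotient.sound h₂))

theorem cls_eq_of_ctx {A B : Tm} (h : Ctx HeadAlpha A B) : cls A = cls B :=
  Quotient.sound (Relation.EqvGen.rel _ _ h)

theorem cls_congr {f : Tm → Tm} (hf : ∀ A B, Ctx HeadAlpha A B → Ctx HeadAlpha (f A) (f B))
    {A B : Tm} (h : cls A = cls B) : cls (f A) = cls (f B) := by
  have h' : Relation.EqvGen (Ctx HeadAlpha) A B := Quotient.exact h
  clear h
  induction h' with
  | rel _ _ h => exact cls_eq_of_ctx (hf _ _ h)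
  | refl => rfl
  | symm _ _ _ ih => exact ih.symm
  | trans _ _ _ _ _ ih₁ ih₂ => exact ih₁.trans ih₂

theorem cls_rho {A B : Tm} (h : cls A = cls B) : cls (.rho A) = cls (.rho B) :=
  cls_congr (fun _ _ => .rho) h

theorem cls_app {A B A' B' : Tm} (h : cls A = cls A') (h' : cls B = cls B') :
    cls (.app A B) = cls (.app A' B') :=
  (cls_congr (f := fun A => .app A B) (fun _ _ => .appLeft) h).trans
    (cls_congr (fun _ _ => .appRight) h')

theorem cls_lam (x : ℕ) {A B A' B' : Tm} (h : cls A = cls A') (h' : cls B = cls B') :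
    cls (.lam x A B) = cls (.lam x A' B') :=
  (cls_congr (f := fun A => .lam x A B) (fun _ _ => .lamDom) h).trans
    (cls_congr (fun _ _ => .lamBody) h')

theorem cls_lam_subst_var {x y : ℕ} (R : Tm) {S : Tm} (hx : x ∉ S.bv) (hy : y ∉ S.vars) :
    cls (.lam x R S) = cls (.lam y R (S.subst (.var y) x)) :=
  cls_eq_of_ctx (.base ⟨x, y, R, S, hx, hy, rfl, rfl⟩)

theorem exists_cls_eq_disjoint_bv (S : Tm) (X : Finset ℕ) :
    ∃ S' : Tm, cls S = cls S' ∧ S'.size = S.size ∧ ∀ v ∈ S'.bv, v ∉ X := by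
  induction S generalizing X with
  | const a => exact ⟨.const a, rfl, rfl, by simp [bv]⟩
  | var a => exact ⟨.var a, rfl, rfl, by simp [bv]⟩
  | rho R ih =>
    obtain ⟨R', h, hs, hb⟩ := ih X
    exact ⟨.rho R', cls_rho h, by simp [size, hs], by simpa [bv] using hb⟩
  | app R S ihR ihS =>
    obtain ⟨R', h, hs, hb⟩ := ihR X
    obtain ⟨S', h', hs', hb'⟩ := ihS X
    refine ⟨.app R' S', cls_app h h', by simp [size, hs, hs'], ?_⟩
    simp only [bv, Finset.mem_union]
    grind
  | lam w R S ihR ihS =>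
    obtain ⟨R', h, hs, hb⟩ := ihR X
    obtain ⟨S', h', hs', hb'⟩ := ihS (X ∪ {w})
    obtain ⟨z, hz⟩ := Infinite.exists_notMem_finset (X ∪ S'.vars)
    simp only [Finset.mem_union, not_or] at hz
    have hw : w ∉ S'.bv := fun e => hb' w e (by simp)
    have hzb : z ∉ S'.bv := fun e => hz.2 (by simp [vars, e])
    refine ⟨.lam z R' (S'.subst (.var z) w),
      (cls_lam w h h').trans (cls_lam_subst_var R' hw hz.2),
      by simp [size, size_subst_var hw hzb, hs, hs'], ?_⟩
    simp only [bv, bv_subst_var hw hzb, Finset.mem_union, Finset.mem_singleton]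
    grind

theorem exists_cls_lam_eq (x : ℕ) (R S : Tm) (X : Finset ℕ) :
    ∃ Y : Finset ℕ, X ⊆ Y ∧ ∀ z ∉ Y, ∃ S' : Tm, S'.size = S.size ∧
      cls (.lam x R S) = cls (.lam z R S') := by
  obtain ⟨S', h, hs, hb⟩ := exists_cls_eq_disjoint_bv S {x}
  refine ⟨X ∪ S'.vars, Finset.subset_union_left, fun z hz => ?_⟩
  simp only [Finset.mem_union, not_or] at hz
  have hx : x ∉ S'.bv := fun e => hb x e (by simp)
  have hzb : z ∉ S'.bv := fun e => hz.2 (by simp [vars, e])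
  exact ⟨S'.subst (.var z) x, by rw [size_subst_var hx hzb, hs],
    (cls_lam x rfl h).trans (cls_lam_subst_var R hx hz.2)⟩

theorem cls_eq_of_toLn_eq {A B : Tm} (h : A.toLn = B.toLn) : cls A = cls B := by
  induction hn : A.size using Nat.strong_induction_on generalizing A B with
  | _ n ih =>
  subst hn
  cases A with
  | const a => cases B <;> simp_all [toLn]
  | var a => cases B <;> simp_all [toLn]
  | rho R =>
    cases B <;> simp only [toLn, Ln.rho.injEq, reduceCtorEq] at h
    exact cls_rho (ih _ (by simp [size]) h rfl)
  | app R S =>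
    cases B <;> simp only [toLn, Ln.app.injEq, reduceCtorEq] at h
    exact cls_app (ih _ (by simp only [size]; omega) h.1 rfl)
      (ih _ (by simp only [size]; omega) h.2 rfl)
  | lam x R S =>
    cases B with
    | lam y R' S' =>
      obtain ⟨Y, -, hY⟩ := exists_cls_lam_eq x R S ∅
      obtain ⟨Z, hYZ, hZ⟩ := exists_cls_lam_eq y R' S' Y
      obtain ⟨z, hz⟩ := Infinite.exists_notMem_finset Z
      obtain ⟨S₁, hs, h₁⟩ := hY z (fun e => hz (hYZ e))
      obtain ⟨S₂, -, h₂⟩ := hZ z hz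
      rw [h₁, h₂]
      rw [toLn_eq_of_cls_eq h₁, toLn_eq_of_cls_eq h₂] at h
      simp only [toLn, Ln.lam.injEq] at h
      exact cls_lam z (ih _ (by simp only [size]; omega) h.1 rfl)
        (ih _ (by simp only [size]; omega)
          (Ln.close_injective (lcAt_toLn _) (lcAt_toLn _) h.2) rfl)
    | _ => simp [toLn] at h

theorem cls_eq_iff {A B : Tm} : cls A = cls B ↔ A.toLn = B.toLn :=
  ⟨toLn_eq_of_cls_eq, cls_eq_of_toLn_eq⟩

theorem cls_subst_congr {A B : Tm} (h : cls A = cls B) (T : Tm) (x : ℕ) :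
    cls (A.subst T x) = cls (B.subst T x) := by
  rw [cls_eq_iff, toLn_subst, toLn_subst, toLn_eq_of_cls_eq h]

theorem cls_subst_of_notMem {A : Tm} (T : Tm) {x : ℕ} (h : x ∉ A.fv) :
    cls (A.subst T x) = cls A := by
  rw [cls_eq_iff, toLn_subst, Ln.subst_of_notMem _ (by rwa [fv_toLn])]

theorem cls_lam_subst {x z : ℕ} (w : ℕ) (R : Tm) {S T : Tm} (hS : z ∉ S.fv) (hzx : z ≠ x)
    (hT : z ∉ T.fv) :
    cls ((Tm.lam w R S).subst T x) =
      cls (.lam z (R.subst T x) ((S.subst (.var z) w).subst T x)) := by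
  simp only [cls_eq_iff, toLn, toLn_subst, Ln.subst]
  rw [Ln.close_subst_subst _ _ (by rwa [fv_toLn]) hzx (by rwa [fv_toLn])]

theorem cls_pi_subst {x z : ℕ} (w : ℕ) (R : Tm) {S T : Tm} (hS : z ∉ S.fv) (hzx : z ≠ x)
    (hT : z ∉ T.fv) :
    cls ((Tm.pi w R S).subst T x) =
      cls (Tm.pi z (R.subst T x) ((S.subst (.var z) w).subst T x)) := by
  rw [Tm.pi, Tm.subst]
  exact cls_rho (cls_lam_subst w R hS hzx hT)

theorem Fq_cls (A : Tm) : Fq (cls A) = A.fv := by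
  ext v
  constructor
  · rintro ⟨B, hB, hv⟩
    rw [← fv_toLn, toLn_eq_of_cls_eq hB, fv_toLn] at hv
    exact hv
  · exact fun hv => ⟨A, rfl, hv⟩

theorem fv_subst_subset (S T : Tm) (x : ℕ) : (S.subst T x).fv ⊆ S.fv ∪ T.fv := by
  simpa only [← fv_toLn, toLn_subst] using Ln.fv_subst_subset x T.toLn S.toLn

theorem finite_Fq (q : QTm) : (Fq q).Finite := by
  induction q using Quotient.inductionOn with
  | _ A => exact (Fq_cls A) ▸ A.fv.finite_toSet

theorem finite_FSet {Γ : Set Stmt} (h : Γ.Finite) : (FSet Γ).Finite := by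
  refine (h.biUnion fun st _ => (finite_Fq st.1).union (finite_Fq st.2)).subset ?_
  rintro v ⟨st, hst, hv⟩
  exact Set.mem_biUnion hst hv

theorem FSet_substSet_subset (Γ : Set Stmt) (T : Tm) (x : ℕ) :
    FSet (substSet Γ T x) ⊆ FSet Γ ∪ T.fv := by
  rintro v ⟨-, ⟨A, B, hAB, rfl⟩, hv⟩
  simp only [Fq_cls, Finset.mem_coe] at hv
  rcases hv with hv | hv
  · rcases Finset.mem_union.1 (fv_subst_subset _ _ _ hv) with h | h
    · exact Or.inl ⟨_, hAB, Or.inl (by simpa [Fq_cls] using h)⟩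
    · exact Or.inr h
  · rcases Finset.mem_union.1 (fv_subst_subset _ _ _ hv) with h | h
    · exact Or.inl ⟨_, hAB, Or.inr (by simpa [Fq_cls] using h)⟩
    · exact Or.inr h

theorem substSet_mono {Γ Δ : Set Stmt} (h : Δ ⊆ Γ) (T : Tm) (x : ℕ) :
    substSet Δ T x ⊆ substSet Γ T x := by
  rintro _ ⟨A, B, hAB, rfl⟩
  exact ⟨A, B, h hAB, rfl⟩

theorem substSet_union_singleton_subset (Γ : Set Stmt) (A B T : Tm) (x : ℕ) :
    substSet (Γ ∪ {(cls A, cls B)}) T x ⊆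
      substSet Γ T x ∪ {(cls (A.subst T x), cls (B.subst T x))} := by
  rintro _ ⟨A', B', hAB | hAB, rfl⟩
  · exact Or.inl ⟨A', B', hAB, rfl⟩
  · obtain ⟨hA, hB⟩ := Prod.mk.inj hAB
    exact Or.inr (Prod.ext (cls_subst_congr hA T x) (cls_subst_congr hB T x))

theorem substSet_subset_of_notMem {Γ : Set Stmt} (T : Tm) {x : ℕ} (h : x ∉ FSet Γ) :
    substSet Γ T x ⊆ Γ := by
  rintro _ ⟨A, B, hAB, rfl⟩
  rw [cls_subst_of_notMem T, cls_subst_of_notMem T]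
  · exact hAB
  · exact fun e => h ⟨_, hAB, Or.inr (by simpa [Fq_cls] using e)⟩
  · exact fun e => h ⟨_, hAB, Or.inl (by simpa [Fq_cls] using e)⟩

theorem DeriveN.mono {n : ℕ} {Γ Δ : Set Stmt} {st : Stmt} (h : Δ ⊆ Γ) (hd : DeriveN n Δ st) :
    DeriveN n Γ st := by
  cases n with
  | zero => exact h hd
  | succ n => exact Step.mono h hd

theorem FSet_mono {Γ Δ : Set Stmt} (h : Δ ⊆ Γ) : FSet Δ ⊆ FSet Γ := by
  rintro v ⟨st, hst, hv⟩
  exact ⟨st, h hst, hv⟩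

theorem DeriveN.exists_finite {n : ℕ} {Γ : Set Stmt} {st : Stmt} (h : DeriveN n Γ st) :
    ∃ Δ ⊆ Γ, Δ.Finite ∧ DeriveN n Δ st := by
  induction n generalizing Γ st with
  | zero => exact ⟨{st}, Set.singleton_subset_iff.2 h, Set.finite_singleton _, rfl⟩
  | succ n ih =>
    change Step _ _ _ at h
    induction h with
    | mem h => exact ⟨_, Set.singleton_subset_iff.2 h, Set.finite_singleton _, .mem rfl⟩
    | mono hs _ ih' =>
      obtain ⟨Δ, hΔ, hf, hd⟩ := ih'
      exact ⟨Δ, hΔ.trans hs, hf, hd⟩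
    | app F S P R x h₁ h₂ =>
      obtain ⟨Δ₁, hΔ₁, hf₁, hd₁⟩ := ih h₁
      obtain ⟨Δ₂, hΔ₂, hf₂, hd₂⟩ := ih h₂
      exact ⟨Δ₁ ∪ Δ₂, Set.union_subset hΔ₁ hΔ₂, hf₁.union hf₂,
        .app F S P R x (hd₁.mono Set.subset_union_left) (hd₂.mono Set.subset_union_right)⟩
    | @ab Γ Q S P y hy hQ h =>
      obtain ⟨Δ, hΔ, hf, hd⟩ := ih h
      refine ⟨Δ ∩ Γ, Set.inter_subset_right, hf.inter_of_left _, .ab Q S P y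
        (fun e => hy (FSet_mono Set.inter_subset_right e)) hQ (hd.mono fun st hst => ?_)⟩
      exact (hΔ hst).imp (fun e => ⟨hst, e⟩) id

/-- The simultaneous substitution of `T` for `x` in the subject and predicate of a statement. -/
def substStmt (T : Tm) (x : ℕ) (st : Stmt) : Stmt :=
  (Quotient.map' (s₁ := alphaSetoid) (s₂ := alphaSetoid) (fun A => A.subst T x)
      (fun _ _ h => Quotient.exact (cls_subst_congr (Quotient.sound h) T x)) st.1,
    Quotient.map' (s₁ := alphaSetoid) (s₂ := alphaSetoid) (fun A => A.subst T x)
      (fun _ _ h => Quotient.exact (cls_subst_congr (Quotient.sound h) T x)) st.2)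

theorem substStmt_cls (T : Tm) (x : ℕ) (A B : Tm) :
    substStmt T x (cls A, cls B) = (cls (A.subst T x), cls (B.subst T x)) := rfl

theorem substStmt_mem_substSet {Γ : Set Stmt} {st : Stmt} (T : Tm) (x : ℕ) (h : st ∈ Γ) :
    substStmt T x st ∈ substSet Γ T x := by
  obtain ⟨p, q⟩ := st
  induction p using Quotient.inductionOn with
  | _ A =>
    induction q using Quotient.inductionOn with
    | _ B => exact ⟨A, B, h, rfl⟩

theorem Step.substStmt {n : ℕ}
    (ih : ∀ (Γ : Set Stmt) (st : Stmt) (T : Tm) (x : ℕ), DeriveN n Γ st →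
      DeriveN n (substSet Γ T x) (substStmt T x st))
    {Γ : Set Stmt} {st : Stmt} (T : Tm) (x : ℕ) (hΓ : Γ.Finite) (h : Step (DeriveN n) Γ st) :
    Step (DeriveN n) (substSet Γ T x) (substStmt T x st) := by
  induction h with
  | mem h => exact .mem (substStmt_mem_substSet T x h)
  | mono hs _ ih' => exact .mono (substSet_mono hs T x) (ih' (hΓ.subset hs))
  | @app Γ F S P R w h₁ h₂ =>
    obtain ⟨z, hz⟩ := Infinite.exists_notMem_finset (R.fv ∪ T.fv ∪ {x})
    simp only [Finset.mem_union, Finset.mem_singleton, not_or] at hz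
    have h₁' := ih _ _ T x h₁
    have h₂' := ih _ _ T x h₂
    rw [substStmt_cls] at h₁' h₂' ⊢
    rw [cls_pi_subst w P hz.1.1 hz.2 hz.1.2] at h₁'
    have h := Step.app _ _ _ _ _ h₁' h₂'
    rw [Tm.subst]
    convert h using 2
    rw [cls_eq_iff]
    simp only [toLn_subst, toLn]
    rw [Ln.subst_subst_subst _ _ (by rw [fv_toLn]; exact hz.1.1) hz.2
      (by rw [fv_toLn]; exact hz.1.2)]
  | @ab Γ Q S P y hy hQ h =>
    obtain ⟨z, hz⟩ := Infinite.exists_notMem_finset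
      ((finite_FSet hΓ).toFinset ∪ (Q.fv ∪ S.fv ∪ P.fv ∪ T.fv ∪ {x}))
    simp only [Finset.mem_union, Finset.mem_singleton, not_or, Set.Finite.mem_toFinset] at hz
    obtain ⟨hzΓ, ⟨⟨⟨hzQ, hzS⟩, hzP⟩, hzT⟩, hzx⟩ := hz
    have h₁ : DeriveN n (Γ ∪ {(cls (.var z), cls Q)})
        (cls (S.subst (.var z) y), cls (P.subst (.var z) y)) := by
      refine (ih _ _ (.var z) y h).mono ((substSet_union_singleton_subset _ _ _ _ _).trans ?_)
      rw [cls_subst_of_notMem _ hQ, Tm.subst, if_pos rfl]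
      exact Set.union_subset_union_left _ (substSet_subset_of_notMem _ hy)
    have h₂ := (ih _ _ T x h₁).mono (substSet_union_singleton_subset _ _ _ _ _)
    rw [Tm.subst, if_neg hzx, substStmt_cls] at h₂
    rw [substStmt_cls, cls_lam_subst y Q hzS hzx hzT, cls_pi_subst y Q hzP hzx hzT]
    refine .ab _ _ _ z (fun e => ?_) (fun e => ?_) h₂
    · exact (FSet_substSet_subset _ _ _ e).elim hzΓ hzT
    · exact (Finset.mem_union.1 (fv_subst_subset _ _ _ e)).elim hzQ hzT

theorem DeriveN.substStmt {n : ℕ} {Γ : Set Stmt} {st : Stmt} (T : Tm) (x : ℕ)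
    (h : DeriveN n Γ st) : DeriveN n (substSet Γ T x) (substStmt T x st) := by
  induction n generalizing Γ st T x with
  | zero => exact substStmt_mem_substSet T x h
  | succ n ih =>
    obtain ⟨Δ, hΔ, hf, hd⟩ := h.exists_finite
    exact DeriveN.mono (substSet_mono hΔ T x)
      (Step.substStmt (fun _ _ T x h => ih T x h) T x hf hd)

/-- substitution invariance: if `Γ ⊢_n (S : P)` then
`Γ[T/x] ⊢_n (S[T/x] : P[T/x])`. -/
theorem deriveN_subst (n : ℕ) (Γ : Set Stmt) (P S T : Tm) (x : ℕ) :
    DeriveN n Γ (cls S, cls P) →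
      DeriveN n (substSet Γ T x) (cls (S.subst T x), cls (P.subst T x)) :=
  fun h => h.substStmt T x

end Paper
end
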